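/- Let φ be a nondegenerate Bernstein function of class B_N with data (m, σ², Π̄), let ψ(u) = u φ(u), and set Θ_φ(0,b) = ∫_0^∞ log( |φ(b u + i b)| / φ(b u) ) du for b > 0. Then: (i) for every b > 0, Θ_φ(0,b) ≥ log( 1 + (2/(3 e π²)) · Π̄(1/b)/(b φ(b)) ); (ii) if σ² > 0, or if liminf_{u→∞} Π̄(1/u)/ψ(u) > 0, then liminf_{b→∞} Θ_φ(0,b) > 0. (Paper: Theorem 1.3, item (1), the inclusion N_G ⊆ N_Θ, proved via inequalities (eq:ubdpp), (eq:ubH) and (eq:lowerBoundH).) -/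

import Mathlib

open MeasureTheory

/-- The quantity `Θ_φ(a,b) = ∫_{a/b}^∞ log(|φ(bu + ib)|/φ(bu)) du`. -/
noncomputable def Theta (φC : ℂ → ℂ) (a b : ℝ) : ℝ :=
  ∫ u in Set.Ioi (a / b),
    Real.log (‖φC (((b * u : ℝ) : ℂ) + (b : ℂ) * Complex.I)‖ / (φC ((b * u : ℝ) : ℂ)).re)

namespace BNaux

lemma norm_one_sub_exp_le (z : ℂ) (hz : 0 ≤ z.re) (y : ℝ) (hy : 0 < y) :
    ‖1 - Complex.exp (-(z * (y : ℂ)))‖ ≤ 2 * (1 + ‖z‖) * min 1 y := by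
  have h2 : ‖1 - Complex.exp (-(z * (y : ℂ)))‖ ≤ 2 := by
    have h : ‖Complex.exp (-(z * (y : ℂ)))‖ ≤ 1 := by
      rw [Complex.norm_exp, Real.exp_le_one_iff]
      simp
      positivity
    calc _ ≤ ‖(1:ℂ)‖ + ‖Complex.exp (-(z * (y : ℂ)))‖ := norm_sub_le _ _
      _ ≤ 2 := by simp; linarith
  have hz0 := norm_nonneg z
  have hn : ‖-(z * (y : ℂ))‖ = ‖z‖ * y := by
    rw [norm_neg, norm_mul, Complex.norm_real, Real.norm_of_nonneg hy.le]
  rcases le_total 1 y with h1 | h1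
  · rw [min_eq_left h1]; linarith
  · rw [min_eq_right h1]
    by_cases hs : ‖z‖ * y ≤ 1
    · have := Complex.norm_exp_sub_one_le (x := -(z * (y : ℂ))) (by rw [hn]; exact hs)
      rw [hn] at this
      rw [norm_sub_rev]
      nlinarith
    · push Not at hs
      nlinarith

section
variable {Pib : ℝ → ℝ}

lemma aemeas (hanti : ∀ x y : ℝ, 0 < x → x ≤ y → Pib y ≤ Pib x) :
    AEStronglyMeasurable Pib (volume.restrict (Set.Ioi (0:ℝ))) := by
  apply AEMeasurable.aestronglyMeasurable
  apply aemeasurable_restrict_of_antitoneOn measurableSet_Ioi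
  intro x hx y _ hxy
  exact hanti x y hx hxy

lemma integrable_c (h0 : ∀ y : ℝ, 0 < y → 0 ≤ Pib y)
    (hanti : ∀ x y : ℝ, 0 < x → x ≤ y → Pib y ≤ Pib x)
    (hint : IntegrableOn (fun y : ℝ => min 1 y * Pib y) (Set.Ioi 0))
    (z : ℂ) (hz : 0 ≤ z.re) :
    IntegrableOn (fun y : ℝ => (1 - Complex.exp (-(z * (y : ℂ)))) * (Pib y : ℂ)) (Set.Ioi 0) := by
  refine Integrable.mono' (hint.const_mul (2 * (1 + ‖z‖))) ?_ ?_
  · refine AEStronglyMeasurable.mul ?_ ?_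
    · exact Continuous.aestronglyMeasurable (by fun_prop)
    · exact Complex.continuous_ofReal.comp_aestronglyMeasurable (aemeas hanti)
  · filter_upwards [ae_restrict_mem measurableSet_Ioi] with y hy
    rw [norm_mul, Complex.norm_real, Real.norm_of_nonneg (h0 y hy)]
    have := norm_one_sub_exp_le z hz y hy
    have := mul_le_mul_of_nonneg_right this (h0 y hy)
    linarith

/-- real integrand -/
noncomputable def F (Pib : ℝ → ℝ) (x b y : ℝ) : ℝ :=
  (1 - Real.exp (-(x * y)) * Real.cos (b * y)) * Pib y
/-- imaginary integrand -/
noncomputable def G (Pib : ℝ → ℝ) (x b y : ℝ) : ℝ :=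
  (Real.exp (-(x * y)) * Real.sin (b * y)) * Pib y

lemma re_im (x b y : ℝ) :
    (((1 - Complex.exp (-(((x:ℂ) + (b:ℂ) * Complex.I) * (y : ℂ)))) * (Pib y : ℂ)).re = F Pib x b y) ∧
    (((1 - Complex.exp (-(((x:ℂ) + (b:ℂ) * Complex.I) * (y : ℂ)))) * (Pib y : ℂ)).im = G Pib x b y) := by
  constructor <;> simp [F, G, Complex.exp_re, Complex.exp_im]

lemma integrable_F (h0 : ∀ y : ℝ, 0 < y → 0 ≤ Pib y)
    (hanti : ∀ x y : ℝ, 0 < x → x ≤ y → Pib y ≤ Pib x)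
    (hint : IntegrableOn (fun y : ℝ => min 1 y * Pib y) (Set.Ioi 0))
    (x b : ℝ) (hx : 0 ≤ x) : IntegrableOn (F Pib x b) (Set.Ioi 0) := by
  have := (integrable_c h0 hanti hint ((x:ℂ) + (b:ℂ) * Complex.I) (by simpa using hx)).re
  refine this.congr (Filter.Eventually.of_forall fun y => ?_)
  exact (re_im x b y).1

lemma integrable_G (h0 : ∀ y : ℝ, 0 < y → 0 ≤ Pib y)
    (hanti : ∀ x y : ℝ, 0 < x → x ≤ y → Pib y ≤ Pib x)
    (hint : IntegrableOn (fun y : ℝ => min 1 y * Pib y) (Set.Ioi 0))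
    (x b : ℝ) (hx : 0 ≤ x) : IntegrableOn (G Pib x b) (Set.Ioi 0) := by
  have := (integrable_c h0 hanti hint ((x:ℂ) + (b:ℂ) * Complex.I) (by simpa using hx)).im
  refine this.congr (Filter.Eventually.of_forall fun y => ?_)
  exact (re_im x b y).2

lemma phi_re {φC : ℂ → ℂ} {m σ2 : ℝ} (h0 : ∀ y : ℝ, 0 < y → 0 ≤ Pib y)
    (hanti : ∀ x y : ℝ, 0 < x → x ≤ y → Pib y ≤ Pib x)
    (hint : IntegrableOn (fun y : ℝ => min 1 y * Pib y) (Set.Ioi 0))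
    (hrepC : ∀ z : ℂ, 0 ≤ z.re →
      φC z = (m : ℂ) + (σ2 : ℂ) * z
        + ∫ y in Set.Ioi (0:ℝ), (1 - Complex.exp (-(z * (y : ℂ)))) * (Pib y : ℂ))
    (x b : ℝ) (hx : 0 ≤ x) :
    (φC ((x:ℂ) + (b:ℂ) * Complex.I)).re = m + σ2 * x + ∫ y in Set.Ioi (0:ℝ), F Pib x b y := by
  have hi := integrable_c h0 hanti hint ((x:ℂ) + (b:ℂ) * Complex.I) (by simpa using hx)
  have := integral_re hi
  rw [hrepC _ (by simpa using hx)]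
  simp only [RCLike.re_eq_complex_re, (re_im x b _).1] at this
  simp only [Complex.add_re, ← this]
  simp

lemma phi_im {φC : ℂ → ℂ} {m σ2 : ℝ} (h0 : ∀ y : ℝ, 0 < y → 0 ≤ Pib y)
    (hanti : ∀ x y : ℝ, 0 < x → x ≤ y → Pib y ≤ Pib x)
    (hint : IntegrableOn (fun y : ℝ => min 1 y * Pib y) (Set.Ioi 0))
    (hrepC : ∀ z : ℂ, 0 ≤ z.re →
      φC z = (m : ℂ) + (σ2 : ℂ) * z
        + ∫ y in Set.Ioi (0:ℝ), (1 - Complex.exp (-(z * (y : ℂ)))) * (Pib y : ℂ))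
    (x b : ℝ) (hx : 0 ≤ x) :
    (φC ((x:ℂ) + (b:ℂ) * Complex.I)).im = σ2 * b + ∫ y in Set.Ioi (0:ℝ), G Pib x b y := by
  have hi := integrable_c h0 hanti hint ((x:ℂ) + (b:ℂ) * Complex.I) (by simpa using hx)
  have := integral_im hi
  rw [hrepC _ (by simpa using hx)]
  simp only [RCLike.im_eq_complex_im, (re_im x b _).2] at this
  simp only [Complex.add_im, ← this]
  simp

lemma phi_re0 {φC : ℂ → ℂ} {m σ2 : ℝ} (h0 : ∀ y : ℝ, 0 < y → 0 ≤ Pib y)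
    (hanti : ∀ x y : ℝ, 0 < x → x ≤ y → Pib y ≤ Pib x)
    (hint : IntegrableOn (fun y : ℝ => min 1 y * Pib y) (Set.Ioi 0))
    (hrepC : ∀ z : ℂ, 0 ≤ z.re →
      φC z = (m : ℂ) + (σ2 : ℂ) * z
        + ∫ y in Set.Ioi (0:ℝ), (1 - Complex.exp (-(z * (y : ℂ)))) * (Pib y : ℂ))
    (x : ℝ) (hx : 0 ≤ x) :
    (φC (x:ℂ)).re = m + σ2 * x + ∫ y in Set.Ioi (0:ℝ), F Pib x 0 y := by
  have := phi_re h0 hanti hint hrepC x 0 hx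
  simpa using this

lemma F_nonneg (h0 : ∀ y : ℝ, 0 < y → 0 ≤ Pib y) (x b y : ℝ) (hx : 0 ≤ x) (hy : 0 < y) :
    0 ≤ F Pib x b y := by
  unfold F
  refine mul_nonneg ?_ (h0 y hy)
  have h1 : Real.exp (-(x * y)) ≤ 1 := by
    rw [Real.exp_le_one_iff]; have := mul_nonneg hx hy.le; linarith
  have h2 := Real.cos_le_one (b * y)
  have h3 := Real.exp_pos (-(x * y))
  nlinarith

lemma F_zero_le (h0 : ∀ y : ℝ, 0 < y → 0 ≤ Pib y) (x b y : ℝ) (hy : 0 < y) :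
    F Pib x 0 y ≤ F Pib x b y := by
  unfold F
  refine mul_le_mul_of_nonneg_right ?_ (h0 y hy)
  have h2 := Real.cos_le_one (b * y)
  have h3 := Real.exp_pos (-(x * y))
  simp
  nlinarith

lemma exp_quad (s : ℝ) (hs : 0 ≤ s) :
    Real.exp (-s) * (1 + s + s ^ 2 / 2) ≤ 1 := by
  have h1 := Real.quadratic_le_exp_of_nonneg hs
  have h2 := Real.exp_pos (-s)
  calc _ ≤ Real.exp (-s) * Real.exp s := by gcongr
    _ = 1 := by rw [← Real.exp_add]; simp

lemma F_le (h0 : ∀ y : ℝ, 0 < y → 0 ≤ Pib y) (x u y : ℝ) (hx : 0 < x) (hy : 0 < y)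
    {b : ℝ} (hb : x = b * u) (hu : 0 < u) :
    F Pib x b y ≤ (1 + 1 / u ^ 2) * F Pib x 0 y := by
  unfold F
  rw [← mul_assoc]
  refine mul_le_mul_of_nonneg_right ?_ (h0 y hy)
  have h1 := exp_quad (x * y) (by positivity)
  have h2 := Real.one_sub_sq_div_two_le_cos (x := b * y)
  have h3 := Real.exp_pos (-(x * y))
  set e := Real.exp (-(x * y))
  simp only [zero_mul, Real.cos_zero, mul_one]
  have h4 : e * ((x * y) ^ 2 / 2) ≤ 1 - e := by
    have : 0 ≤ e * (x * y) := by positivity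
    nlinarith
  have h5 : e * ((b * y) ^ 2 / 2) = 1 / u ^ 2 * (e * ((x * y) ^ 2 / 2)) := by
    rw [hb]; field_simp
  have h6 : 1 / u ^ 2 * (e * ((x * y) ^ 2 / 2)) ≤ 1 / u ^ 2 * (1 - e) := by gcongr
  have h7 : e * (1 - (b * y) ^ 2 / 2) ≤ e * Real.cos (b * y) := by gcongr
  nlinarith

lemma G_le (h0 : ∀ y : ℝ, 0 < y → 0 ≤ Pib y) (x u y : ℝ) (hx : 0 < x) (hy : 0 < y)
    {b : ℝ} (hb : x = b * u) (hu : 0 < u) (hb0 : 0 < b) :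
    |G Pib x b y| ≤ (1 / u) * F Pib x 0 y := by
  unfold F G
  rw [← mul_assoc, abs_mul, abs_of_nonneg (h0 y hy)]
  refine mul_le_mul_of_nonneg_right ?_ (h0 y hy)
  have h1 := exp_quad (x * y) (by positivity)
  have h3 := Real.exp_pos (-(x * y))
  rw [abs_mul, abs_of_pos h3]
  set e := Real.exp (-(x * y))
  have h2 : |Real.sin (b * y)| ≤ b * y := by
    have := Real.abs_sin_le_abs (x := b * y)
    rwa [abs_of_pos (by positivity : 0 < b * y)] at this
  simp only [zero_mul, Real.cos_zero, mul_one]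
  have h4 : e * (x * y) ≤ 1 - e := by
    have : 0 ≤ e * ((x * y) ^ 2 / 2) := by positivity
    nlinarith
  calc e * |Real.sin (b * y)| ≤ e * (b * y) := by gcongr
    _ = 1 / u * (e * (x * y)) := by rw [hb]; field_simp
    _ ≤ _ := by gcongr

lemma G_abs_le (h0 : ∀ y : ℝ, 0 < y → 0 ≤ Pib y) (x b y : ℝ) (hx : 0 ≤ x) (hy : 0 < y)
    (hb : 0 < b) : |G Pib x b y| ≤ b * (min (1 / b) y * Pib y) := by
  unfold G
  rw [← mul_assoc, abs_mul, abs_of_nonneg (h0 y hy)]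
  refine mul_le_mul_of_nonneg_right ?_ (h0 y hy)
  have h1 : Real.exp (-(x * y)) ≤ 1 := by
    rw [Real.exp_le_one_iff]; have := mul_nonneg hx hy.le; linarith
  have h3 := Real.exp_pos (-(x * y))
  rw [abs_mul, abs_of_pos h3]
  have h2 : |Real.sin (b * y)| ≤ b * y := by
    have := Real.abs_sin_le_abs (x := b * y)
    rwa [abs_of_pos (by positivity : 0 < b * y)] at this
  have h4 := Real.abs_sin_le_one (b * y)
  have h5 : b * min (1 / b) y = min 1 (b * y) := by
    rw [mul_min_of_nonneg _ _ hb.le]; congr 1; field_simp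
  rw [h5]
  calc _ ≤ 1 * |Real.sin (b * y)| := by gcongr
    _ ≤ _ := by rw [one_mul]; exact le_min h4 h2

end

/-- positivity -/
lemma phi_pos {Pib : ℝ → ℝ} {φC : ℂ → ℂ} {m σ2 : ℝ} (hm : 0 ≤ m) (hσ : 0 ≤ σ2)
    (h0 : ∀ y : ℝ, 0 < y → 0 ≤ Pib y)
    (hanti : ∀ x y : ℝ, 0 < x → x ≤ y → Pib y ≤ Pib x)
    (hint : IntegrableOn (fun y : ℝ => min 1 y * Pib y) (Set.Ioi 0))
    (hrepC : ∀ z : ℂ, 0 ≤ z.re →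
      φC z = (m : ℂ) + (σ2 : ℂ) * z
        + ∫ y in Set.Ioi (0:ℝ), (1 - Complex.exp (-(z * (y : ℂ)))) * (Pib y : ℂ))
    (hnd : ¬ (m = 0 ∧ σ2 = 0 ∧ ∀ y : ℝ, 0 < y → Pib y = 0))
    (x : ℝ) (hx : 0 < x) : 0 < (φC (x:ℂ)).re := by
  rw [phi_re0 h0 hanti hint hrepC x hx.le]
  have hI : 0 ≤ ∫ y in Set.Ioi (0:ℝ), F Pib x 0 y :=
    setIntegral_nonneg measurableSet_Ioi fun y hy => F_nonneg h0 x 0 y hx.le hy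
  have hs : 0 ≤ σ2 * x := by positivity
  by_cases h1 : m = 0
  swap
  · have : 0 < m := lt_of_le_of_ne hm (Ne.symm h1)
    linarith
  by_cases h2 : σ2 = 0
  swap
  · have : 0 < σ2 := lt_of_le_of_ne hσ (Ne.symm h2)
    have : 0 < σ2 * x := by positivity
    linarith
  have h3 : ∃ y : ℝ, 0 < y ∧ Pib y ≠ 0 := by
    by_contra hcon
    push Not at hcon
    exact hnd ⟨h1, h2, hcon⟩
  obtain ⟨y0, hy0, hP⟩ := h3
  have hP0 : 0 < Pib y0 := lt_of_le_of_ne (h0 y0 hy0) (Ne.symm hP)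
  have : 0 < ∫ y in Set.Ioi (0:ℝ), F Pib x 0 y := by
    rw [setIntegral_pos_iff_support_of_nonneg_ae]
    · have hsub : Set.Ioo 0 y0 ⊆ Function.support (F Pib x 0) ∩ Set.Ioi 0 := by
        intro y hy
        refine ⟨?_, hy.1⟩
        have hPy : 0 < Pib y := hP0.trans_le (hanti y y0 hy.1 hy.2.le)
        have he : Real.exp (-(x * y)) < 1 := by
          rw [Real.exp_lt_one_iff]
          have := mul_pos hx hy.1
          linarith
        simp only [Function.mem_support, F, zero_mul, Real.cos_zero, mul_one]
        have : 0 < (1 - Real.exp (-(x * y))) * Pib y := mul_pos (by linarith) hPy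
        exact this.ne'
      refine lt_of_lt_of_le ?_ (measure_mono hsub)
      simp [hy0]
    · filter_upwards [ae_restrict_mem measurableSet_Ioi] with y hy
      exact F_nonneg h0 x 0 y hx.le hy
    · exact integrable_F h0 hanti hint x 0 hx.le
  linarith

lemma norm_le {Pib : ℝ → ℝ} {φC : ℂ → ℂ} {m σ2 : ℝ} (hm : 0 ≤ m) (hσ : 0 ≤ σ2)
    (h0 : ∀ y : ℝ, 0 < y → 0 ≤ Pib y)
    (hanti : ∀ x y : ℝ, 0 < x → x ≤ y → Pib y ≤ Pib x)
    (hint : IntegrableOn (fun y : ℝ => min 1 y * Pib y) (Set.Ioi 0))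
    (hrepC : ∀ z : ℂ, 0 ≤ z.re →
      φC z = (m : ℂ) + (σ2 : ℂ) * z
        + ∫ y in Set.Ioi (0:ℝ), (1 - Complex.exp (-(z * (y : ℂ)))) * (Pib y : ℂ))
    (b u : ℝ) (hb : 0 < b) (hu : 0 < u) :
    ‖φC (((b * u : ℝ) : ℂ) + (b : ℂ) * Complex.I)‖ ≤
      (1 + 2 / u ^ 2) * (φC ((b * u : ℝ) : ℂ)).re := by
  have hx : 0 < b * u := by positivity
  have e0 := phi_re0 h0 hanti hint hrepC (b * u) hx.le
  have e1 := phi_re h0 hanti hint hrepC (b * u) b hx.le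
  have e2 := phi_im h0 hanti hint hrepC (b * u) b hx.le
  have iF0 := integrable_F h0 hanti hint (b * u) 0 hx.le
  have iF := integrable_F h0 hanti hint (b * u) b hx.le
  have iG := integrable_G h0 hanti hint (b * u) b hx.le
  have hI0 : 0 ≤ ∫ y in Set.Ioi (0:ℝ), F Pib (b * u) 0 y :=
    setIntegral_nonneg measurableSet_Ioi fun y hy => F_nonneg h0 _ 0 y hx.le hy
  have hI : 0 ≤ ∫ y in Set.Ioi (0:ℝ), F Pib (b * u) b y :=
    setIntegral_nonneg measurableSet_Ioi fun y hy => F_nonneg h0 _ b y hx.le hy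
  have hA : ∫ y in Set.Ioi (0:ℝ), F Pib (b * u) b y ≤
      (1 + 1 / u ^ 2) * ∫ y in Set.Ioi (0:ℝ), F Pib (b * u) 0 y := by
    rw [← integral_const_mul]
    exact setIntegral_mono_on iF (iF0.const_mul _) measurableSet_Ioi
      fun y hy => F_le h0 _ u y hx hy rfl hu
  have hB : |∫ y in Set.Ioi (0:ℝ), G Pib (b * u) b y| ≤
      (1 / u) * ∫ y in Set.Ioi (0:ℝ), F Pib (b * u) 0 y := by
    rw [← integral_const_mul]
    refine (abs_integral_le_integral_abs).trans ?_
    exact setIntegral_mono_on iG.abs (iF0.const_mul _) measurableSet_Ioi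
      fun y hy => G_le h0 _ u y hx hy rfl hu hb
  set I0 := ∫ y in Set.Ioi (0:ℝ), F Pib (b * u) 0 y
  set I := ∫ y in Set.Ioi (0:ℝ), F Pib (b * u) b y
  set J := ∫ y in Set.Ioi (0:ℝ), G Pib (b * u) b y
  set w := φC (((b * u : ℝ) : ℂ) + (b : ℂ) * Complex.I)
  set p := (φC ((b * u : ℝ) : ℂ)).re
  have hs : 0 ≤ σ2 * (b * u) := by positivity
  have hp : 0 ≤ p := by rw [e0]; linarith
  have hr0 : 0 ≤ w.re := by rw [e1]; linarith
  have hr : w.re ≤ (1 + 1 / u ^ 2) * p := by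
    rw [e0, e1]
    have : 0 ≤ 1 / u ^ 2 * (m + σ2 * (b * u)) := by positivity
    nlinarith
  have hi : |w.im| ≤ (1 / u) * p := by
    rw [e0, e2]
    have h1 : σ2 * b = 1 / u * (σ2 * (b * u)) := by field_simp
    have h2 : 0 ≤ 1 / u * m := by positivity
    calc |σ2 * b + J| ≤ |σ2 * b| + |J| := abs_add_le _ _
      _ = σ2 * b + |J| := by rw [abs_of_nonneg (by positivity : 0 ≤ σ2 * b)]
      _ ≤ _ := by rw [h1]; nlinarith
  apply abs_le_of_sq_le_sq' _ (by positivity) |>.2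
  rw [Complex.sq_norm, Complex.normSq_apply]
  have k1 : w.re * w.re ≤ ((1 + 1 / u ^ 2) * p) * ((1 + 1 / u ^ 2) * p) :=
    mul_self_le_mul_self hr0 hr
  have k2 : w.im * w.im ≤ ((1 / u) * p) * ((1 / u) * p) := by
    rw [← abs_mul_abs_self w.im]
    exact mul_self_le_mul_self (abs_nonneg _) hi
  have k3 : 0 ≤ (1 / u ^ 2) * p ^ 2 := by positivity
  have k4 : 0 ≤ (1 / u ^ 2) ^ 2 * p ^ 2 := by positivity
  have k5 : ((1 / u) * p) * ((1 / u) * p) = (1 / u ^ 2) * p ^ 2 := by field_simp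
  have k6 : 2 / u ^ 2 = 2 * (1 / u ^ 2) := by ring
  rw [k6]
  nlinarith

lemma log_bound_integrable :
    IntegrableOn (fun u : ℝ => Real.log (1 + 2 / u ^ 2)) (Set.Ioi 0) := by
  have hmeas : Measurable (fun u : ℝ => Real.log (1 + 2 / u ^ 2)) := by fun_prop
  have hsplit : Set.Ioi (0:ℝ) = Set.Ioc 0 1 ∪ Set.Ioi 1 := by
    rw [Set.Ioc_union_Ioi_eq_Ioi]; norm_num
  rw [hsplit, integrableOn_union]
  constructor
  · have hl : IntegrableOn Real.log (Set.Ioc 0 1) :=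
      (intervalIntegrable_iff_integrableOn_Ioc_of_le zero_le_one).1
        intervalIntegral.intervalIntegrable_log'
    have hc : IntegrableOn (fun _ : ℝ => Real.log 3) (Set.Ioc (0:ℝ) 1) :=
      integrableOn_const (by simp)
    refine Integrable.mono' (hc.sub (hl.const_mul 2)) hmeas.aestronglyMeasurable ?_
    filter_upwards [ae_restrict_mem measurableSet_Ioc] with u hu
    have hu0 := hu.1
    have hnn : 0 ≤ 2 / u ^ 2 := by positivity
    rw [Real.norm_of_nonneg (Real.log_nonneg (by linarith))]
    have h1 : 1 + 2 / u ^ 2 ≤ 3 / u ^ 2 := by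
      rw [← sub_nonneg]
      have : 3 / u ^ 2 - (1 + 2 / u ^ 2) = (1 - u ^ 2) / u ^ 2 := by field_simp; ring
      rw [this]
      apply div_nonneg _ (by positivity)
      have := hu.2
      nlinarith
    calc Real.log (1 + 2 / u ^ 2) ≤ Real.log (3 / u ^ 2) := Real.log_le_log (by linarith) h1
      _ = Real.log 3 - 2 * Real.log u := by
        rw [Real.log_div (by norm_num) (by positivity), Real.log_pow]; norm_num
  · have hr : IntegrableOn (fun u : ℝ => u ^ (-2:ℝ)) (Set.Ioi 1) :=
      integrableOn_Ioi_rpow_of_lt (by norm_num) one_pos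
    refine Integrable.mono' (hr.const_mul 2) hmeas.aestronglyMeasurable ?_
    filter_upwards [ae_restrict_mem measurableSet_Ioi] with u hu
    have hu0 : 0 < u := lt_trans one_pos hu
    have hnn : 0 ≤ 2 / u ^ 2 := by positivity
    rw [Real.norm_of_nonneg (Real.log_nonneg (by linarith))]
    have := Real.log_le_sub_one_of_pos (x := 1 + 2 / u ^ 2) (by linarith)
    have h2 : u ^ (-2:ℝ) = 1 / u ^ 2 := by
      rw [Real.rpow_neg hu0.le]; norm_cast; simp
    rw [h2]
    have h3 : 2 / u ^ 2 = 2 * (1 / u ^ 2) := by ring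
    linarith

lemma meas_theta {Pib : ℝ → ℝ} {φC : ℂ → ℂ} {m σ2 : ℝ}
    (hanti : ∀ x y : ℝ, 0 < x → x ≤ y → Pib y ≤ Pib x)
    (hrepC : ∀ z : ℂ, 0 ≤ z.re →
      φC z = (m : ℂ) + (σ2 : ℂ) * z
        + ∫ y in Set.Ioi (0:ℝ), (1 - Complex.exp (-(z * (y : ℂ)))) * (Pib y : ℂ))
    (b c : ℝ) (hb : 0 < b) :
    AEStronglyMeasurable (fun u : ℝ => φC (((b * u : ℝ) : ℂ) + (c : ℂ) * Complex.I))
      (volume.restrict (Set.Ioi 0)) := by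
  have h1 : AEStronglyMeasurable
      (fun p : ℝ × ℝ => (1 - Complex.exp (-((((b * p.1 : ℝ) : ℂ) + (c : ℂ) * Complex.I) * (p.2 : ℂ))))
        * (Pib p.2 : ℂ))
      ((volume.restrict (Set.Ioi (0:ℝ))).prod (volume.restrict (Set.Ioi (0:ℝ)))) := by
    refine AEStronglyMeasurable.mul ?_ ?_
    · exact Continuous.aestronglyMeasurable (by fun_prop)
    · exact (Complex.continuous_ofReal.comp_aestronglyMeasurable (aemeas hanti)).comp_snd
  have h2 := h1.integral_prod_right'
  have h3 : AEStronglyMeasurable (fun u : ℝ => (m : ℂ) + (σ2 : ℂ) * (((b * u : ℝ) : ℂ) + (c : ℂ) * Complex.I))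
      (volume.restrict (Set.Ioi 0)) := Continuous.aestronglyMeasurable (by fun_prop)
  refine (h3.add h2).congr ?_
  filter_upwards [ae_restrict_mem measurableSet_Ioi] with u hu
  have : 0 ≤ b * u := mul_nonneg hb.le (le_of_lt hu)
  rw [hrepC _ (by simpa using this)]
  rfl

lemma re_le_re {Pib : ℝ → ℝ} {φC : ℂ → ℂ} {m σ2 : ℝ}
    (h0 : ∀ y : ℝ, 0 < y → 0 ≤ Pib y)
    (hanti : ∀ x y : ℝ, 0 < x → x ≤ y → Pib y ≤ Pib x)
    (hint : IntegrableOn (fun y : ℝ => min 1 y * Pib y) (Set.Ioi 0))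
    (hrepC : ∀ z : ℂ, 0 ≤ z.re →
      φC z = (m : ℂ) + (σ2 : ℂ) * z
        + ∫ y in Set.Ioi (0:ℝ), (1 - Complex.exp (-(z * (y : ℂ)))) * (Pib y : ℂ))
    (x b : ℝ) (hx : 0 ≤ x) :
    (φC (x : ℂ)).re ≤ (φC ((x : ℂ) + (b : ℂ) * Complex.I)).re := by
  rw [phi_re0 h0 hanti hint hrepC x hx, phi_re h0 hanti hint hrepC x b hx]
  have := setIntegral_mono_on (integrable_F h0 hanti hint x 0 hx) (integrable_F h0 hanti hint x b hx)
    measurableSet_Ioi fun y hy => F_zero_le h0 x b y hy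
  linarith

lemma theta_facts {Pib : ℝ → ℝ} {φC : ℂ → ℂ} {m σ2 : ℝ} (hm : 0 ≤ m) (hσ : 0 ≤ σ2)
    (h0 : ∀ y : ℝ, 0 < y → 0 ≤ Pib y)
    (hanti : ∀ x y : ℝ, 0 < x → x ≤ y → Pib y ≤ Pib x)
    (hint : IntegrableOn (fun y : ℝ => min 1 y * Pib y) (Set.Ioi 0))
    (hrepC : ∀ z : ℂ, 0 ≤ z.re →
      φC z = (m : ℂ) + (σ2 : ℂ) * z
        + ∫ y in Set.Ioi (0:ℝ), (1 - Complex.exp (-(z * (y : ℂ)))) * (Pib y : ℂ))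
    (hnd : ¬ (m = 0 ∧ σ2 = 0 ∧ ∀ y : ℝ, 0 < y → Pib y = 0))
    (b : ℝ) (hb : 0 < b) :
    Theta φC 0 b ≤ ∫ u in Set.Ioi (0:ℝ), Real.log (1 + 2 / u ^ 2) ∧
    ∀ L : ℝ, (∀ u : ℝ, 0 < u → u ≤ 1 →
      L ≤ Real.log (‖φC (((b * u : ℝ) : ℂ) + (b : ℂ) * Complex.I)‖ / (φC ((b * u : ℝ) : ℂ)).re)) →
      L ≤ Theta φC 0 b := by
  set f : ℝ → ℝ := fun u =>
    Real.log (‖φC (((b * u : ℝ) : ℂ) + (b : ℂ) * Complex.I)‖ / (φC ((b * u : ℝ) : ℂ)).re) with hf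
  have hT : Theta φC 0 b = ∫ u in Set.Ioi (0:ℝ), f u := by
    simp only [Theta, zero_div, hf]
  have hpos : ∀ u : ℝ, 0 < u → 0 < (φC ((b * u : ℝ) : ℂ)).re := fun u hu =>
    phi_pos hm hσ h0 hanti hint hrepC hnd _ (mul_pos hb hu)
  have hge : ∀ u : ℝ, 0 < u →
      1 ≤ ‖φC (((b * u : ℝ) : ℂ) + (b : ℂ) * Complex.I)‖ / (φC ((b * u : ℝ) : ℂ)).re := by
    intro u hu
    rw [one_le_div (hpos u hu)]
    exact (re_le_re h0 hanti hint hrepC (b * u) b (mul_pos hb hu).le).trans (Complex.re_le_norm _)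
  have hnn : ∀ u : ℝ, 0 < u → 0 ≤ f u := fun u hu => Real.log_nonneg (hge u hu)
  have hle : ∀ u : ℝ, 0 < u → f u ≤ Real.log (1 + 2 / u ^ 2) := by
    intro u hu
    refine Real.log_le_log (lt_of_lt_of_le one_pos (hge u hu)) ?_
    rw [div_le_iff₀ (hpos u hu)]
    exact norm_le hm hσ h0 hanti hint hrepC b u hb hu
  have hmeas : AEStronglyMeasurable f (volume.restrict (Set.Ioi 0)) := by
    have h1 := (meas_theta hanti hrepC b b hb).norm.aemeasurable
    have h2 := (Complex.continuous_re.comp_aestronglyMeasurable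
      (meas_theta hanti hrepC b 0 hb)).aemeasurable
    simp only [Complex.ofReal_zero, zero_mul, add_zero] at h2
    exact (Real.measurable_log.comp_aemeasurable (h1.div h2)).aestronglyMeasurable
  have hfi : IntegrableOn f (Set.Ioi 0) := by
    refine Integrable.mono' log_bound_integrable hmeas ?_
    filter_upwards [ae_restrict_mem measurableSet_Ioi] with u hu
    rw [Real.norm_of_nonneg (hnn u hu)]
    exact hle u hu
  rw [hT]
  constructor
  · exact setIntegral_mono_on hfi log_bound_integrable measurableSet_Ioi fun u hu => hle u hu
  · intro L hL
    have hsub : Set.Ioc (0:ℝ) 1 ⊆ Set.Ioi 0 := fun u hu => hu.1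
    calc L = ∫ u in Set.Ioc (0:ℝ) 1, L := by simp
      _ ≤ ∫ u in Set.Ioc (0:ℝ) 1, f u :=
        setIntegral_mono_on (integrableOn_const (by simp)) (hfi.mono_set hsub) measurableSet_Ioc
          fun u hu => hL u hu.1 hu.2
      _ ≤ ∫ u in Set.Ioi (0:ℝ), f u := by
        refine setIntegral_mono_set hfi ?_ hsub.eventuallyLE
        filter_upwards [ae_restrict_mem measurableSet_Ioi] with u hu
        exact hnn u hu

lemma phi_mono {Pib : ℝ → ℝ} {φC : ℂ → ℂ} {m σ2 : ℝ} (hσ : 0 ≤ σ2)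
    (h0 : ∀ y : ℝ, 0 < y → 0 ≤ Pib y)
    (hanti : ∀ x y : ℝ, 0 < x → x ≤ y → Pib y ≤ Pib x)
    (hint : IntegrableOn (fun y : ℝ => min 1 y * Pib y) (Set.Ioi 0))
    (hrepC : ∀ z : ℂ, 0 ≤ z.re →
      φC z = (m : ℂ) + (σ2 : ℂ) * z
        + ∫ y in Set.Ioi (0:ℝ), (1 - Complex.exp (-(z * (y : ℂ)))) * (Pib y : ℂ))
    (x b : ℝ) (hx : 0 ≤ x) (hxb : x ≤ b) :
    (φC (x : ℂ)).re ≤ (φC (b : ℂ)).re := by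
  rw [phi_re0 h0 hanti hint hrepC x hx, phi_re0 h0 hanti hint hrepC b (hx.trans hxb)]
  have : ∫ y in Set.Ioi (0:ℝ), F Pib x 0 y ≤ ∫ y in Set.Ioi (0:ℝ), F Pib b 0 y := by
    refine setIntegral_mono_on (integrable_F h0 hanti hint x 0 hx)
      (integrable_F h0 hanti hint b 0 (hx.trans hxb)) measurableSet_Ioi fun y hy => ?_
    have hy' : 0 < y := hy
    unfold F
    refine mul_le_mul_of_nonneg_right ?_ (h0 y hy)
    simp only [zero_mul, Real.cos_zero, mul_one]
    have : Real.exp (-(b * y)) ≤ Real.exp (-(x * y)) := by gcongr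
    linarith
  have : σ2 * x ≤ σ2 * b := by gcongr
  linarith

lemma A_lower {Pib : ℝ → ℝ} {φC : ℂ → ℂ} {m σ2 : ℝ}
    (h0 : ∀ y : ℝ, 0 < y → 0 ≤ Pib y)
    (hanti : ∀ x y : ℝ, 0 < x → x ≤ y → Pib y ≤ Pib x)
    (hint : IntegrableOn (fun y : ℝ => min 1 y * Pib y) (Set.Ioi 0))
    (hrepC : ∀ z : ℂ, 0 ≤ z.re →
      φC z = (m : ℂ) + (σ2 : ℂ) * z
        + ∫ y in Set.Ioi (0:ℝ), (1 - Complex.exp (-(z * (y : ℂ)))) * (Pib y : ℂ))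
    (x b : ℝ) (hx : 0 ≤ x) (hb : 0 < b) (hxb : x ≤ b) :
    (φC (x : ℂ)).re + 2 / (3 * Real.exp 1 * Real.pi ^ 2) * (Pib (1 / b) / b) ≤
      (φC ((x : ℂ) + (b : ℂ) * Complex.I)).re := by
  rw [phi_re0 h0 hanti hint hrepC x hx, phi_re h0 hanti hint hrepC x b hx]
  have i0 := integrable_F h0 hanti hint x 0 hx
  have i1 := integrable_F h0 hanti hint x b hx
  have key : 2 / (3 * Real.exp 1 * Real.pi ^ 2) * (Pib (1 / b) / b) ≤
      ∫ y in Set.Ioi (0:ℝ), (F Pib x b y - F Pib x 0 y) := by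
    have hsub : Set.Ioc (0:ℝ) (1 / b) ⊆ Set.Ioi 0 := fun u hu => hu.1
    have hq : IntegrableOn (fun y : ℝ =>
        Real.exp (-1) * (2 / Real.pi ^ 2) * b ^ 2 * Pib (1 / b) * y ^ 2) (Set.Ioc (0:ℝ) (1 / b)) :=
      (Continuous.integrableOn_Icc (by fun_prop)).mono_set Set.Ioc_subset_Icc_self
    calc _ = ∫ y in Set.Ioc (0:ℝ) (1 / b),
          Real.exp (-1) * (2 / Real.pi ^ 2) * b ^ 2 * Pib (1 / b) * y ^ 2 := by
          rw [← intervalIntegral.integral_of_le (by positivity), intervalIntegral.integral_const_mul,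
            integral_pow, Real.exp_neg]
          have := Real.pi_pos
          have := Real.exp_pos 1
          simp only [one_div]
          field_simp
          norm_num
          try field_simp
      _ ≤ ∫ y in Set.Ioc (0:ℝ) (1 / b), (F Pib x b y - F Pib x 0 y) := by
        refine setIntegral_mono_on hq ((i1.sub i0).mono_set hsub) measurableSet_Ioc fun y hy => ?_
        have hy0 := hy.1
        have hP := hanti y (1 / b) hy0 hy.2
        have hby : b * y ≤ 1 := by
          have := hy.2
          rw [le_div_iff₀ hb] at this
          linarith
        have hby0 : 0 < b * y := by positivity
        have hc := Real.cos_le_one_sub_mul_cos_sq (x := b * y) (by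
          rw [abs_of_pos hby0]; linarith [Real.pi_gt_three])
        have he : Real.exp (-1) ≤ Real.exp (-(x * y)) := by
          gcongr
          nlinarith
        have hP0 := h0 (1 / b) (by positivity)
        have e1 : F Pib x b y - F Pib x 0 y =
            Real.exp (-(x * y)) * (1 - Real.cos (b * y)) * Pib y := by
          simp only [F, zero_mul, Real.cos_zero]; ring
        rw [e1]
        calc _ = Real.exp (-1) * (2 / Real.pi ^ 2 * (b * y) ^ 2) * Pib (1 / b) := by ring
          _ ≤ _ := by
            have hc2 : 2 / Real.pi ^ 2 * (b * y) ^ 2 ≤ 1 - Real.cos (b * y) := by linarith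
            have hc3 : 0 ≤ 1 - Real.cos (b * y) := by linarith [Real.cos_le_one (b * y)]
            gcongr
      _ ≤ _ := by
        refine setIntegral_mono_set (i1.sub i0) ?_ hsub.eventuallyLE
        filter_upwards [ae_restrict_mem measurableSet_Ioi] with y hy
        exact sub_nonneg.2 (F_zero_le h0 x b y hy)
  rw [integral_sub i1 i0] at key
  linarith

lemma part_one {Pib : ℝ → ℝ} {φC : ℂ → ℂ} {m σ2 : ℝ} (hm : 0 ≤ m) (hσ : 0 ≤ σ2)
    (h0 : ∀ y : ℝ, 0 < y → 0 ≤ Pib y)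
    (hanti : ∀ x y : ℝ, 0 < x → x ≤ y → Pib y ≤ Pib x)
    (hint : IntegrableOn (fun y : ℝ => min 1 y * Pib y) (Set.Ioi 0))
    (hrepC : ∀ z : ℂ, 0 ≤ z.re →
      φC z = (m : ℂ) + (σ2 : ℂ) * z
        + ∫ y in Set.Ioi (0:ℝ), (1 - Complex.exp (-(z * (y : ℂ)))) * (Pib y : ℂ))
    (hnd : ¬ (m = 0 ∧ σ2 = 0 ∧ ∀ y : ℝ, 0 < y → Pib y = 0))
    (b : ℝ) (hb : 0 < b) :
    Real.log (1 + 2 / (3 * Real.exp 1 * Real.pi ^ 2)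
          * (Pib (1 / b) / (b * (φC ((b : ℝ) : ℂ)).re))) ≤ Theta φC 0 b := by
  apply (theta_facts hm hσ h0 hanti hint hrepC hnd b hb).2
  intro u hu hu1
  have hx : 0 < b * u := by positivity
  have hxb : b * u ≤ b := by nlinarith
  have hp := phi_pos hm hσ h0 hanti hint hrepC hnd (b * u) hx
  have hpb := phi_pos hm hσ h0 hanti hint hrepC hnd b hb
  have hmono := phi_mono hσ h0 hanti hint hrepC (b * u) b hx.le hxb
  have hA := A_lower h0 hanti hint hrepC (b * u) b hx.le hb hxb
  have hP0 := h0 (1 / b) (by positivity)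
  have hre := Complex.re_le_norm (φC (((b * u : ℝ) : ℂ) + (b : ℂ) * Complex.I))
  set K := 2 / (3 * Real.exp 1 * Real.pi ^ 2) with hK
  have hK0 : 0 < K := by have := Real.pi_pos; positivity
  apply Real.log_le_log
  · positivity
  rw [le_div_iff₀ hp]
  refine le_trans ?_ (hA.trans hre)
  have e : K * (Pib (1 / b) / (b * (φC (b : ℂ)).re)) * (φC ((b * u : ℝ) : ℂ)).re ≤
      K * (Pib (1 / b) / (b * (φC (b : ℂ)).re)) * (φC (b : ℂ)).re := by
    gcongr
  have e2 : K * (Pib (1 / b) / (b * (φC (b : ℂ)).re)) * (φC (b : ℂ)).re = K * (Pib (1 / b) / b) := by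
    field_simp
  linarith

lemma tend_zero {Pib : ℝ → ℝ} (h0 : ∀ y : ℝ, 0 < y → 0 ≤ Pib y)
    (hanti : ∀ x y : ℝ, 0 < x → x ≤ y → Pib y ≤ Pib x)
    (hint : IntegrableOn (fun y : ℝ => min 1 y * Pib y) (Set.Ioi 0)) :
    Filter.Tendsto (fun b : ℝ => ∫ y in Set.Ioi (0:ℝ), min (1 / b) y * Pib y)
      Filter.atTop (nhds 0) := by
  rw [show nhds (0:ℝ) = nhds (∫ y in Set.Ioi (0:ℝ), (0:ℝ)) by simp]
  refine tendsto_integral_filter_of_dominated_convergence (f := fun _ => 0) (fun y : ℝ => min 1 y * Pib y) ?_ ?_ hint ?_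
  · refine Filter.Eventually.of_forall fun b => AEStronglyMeasurable.mul ?_ (aemeas hanti)
    exact Continuous.aestronglyMeasurable (by fun_prop)
  · filter_upwards [Filter.eventually_ge_atTop 1] with b hb
    filter_upwards [ae_restrict_mem measurableSet_Ioi] with y hy
    have hy' : 0 < y := hy
    have h1 : 0 ≤ min (1 / b) y := le_min (by positivity) hy'.le
    have h2 : 1 / b ≤ 1 := by rw [div_le_one (by linarith)]; exact hb
    have := h0 y hy
    rw [Real.norm_of_nonneg (by positivity)]
    gcongr
  · filter_upwards [ae_restrict_mem measurableSet_Ioi] with y hy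
    have hy' : 0 < y := hy
    have h1 : Filter.Tendsto (fun b : ℝ => 1 / b) Filter.atTop (nhds 0) := by
      simpa using tendsto_inv_atTop_zero (𝕜 := ℝ)
    have h2 := (h1.min (tendsto_const_nhds (x := y))).mul_const (Pib y)
    simpa [min_eq_left hy'.le] using h2

lemma phi_le_lin {Pib : ℝ → ℝ} {φC : ℂ → ℂ} {m σ2 : ℝ} (hm : 0 ≤ m)
    (h0 : ∀ y : ℝ, 0 < y → 0 ≤ Pib y)
    (hanti : ∀ x y : ℝ, 0 < x → x ≤ y → Pib y ≤ Pib x)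
    (hint : IntegrableOn (fun y : ℝ => min 1 y * Pib y) (Set.Ioi 0))
    (hrepC : ∀ z : ℂ, 0 ≤ z.re →
      φC z = (m : ℂ) + (σ2 : ℂ) * z
        + ∫ y in Set.Ioi (0:ℝ), (1 - Complex.exp (-(z * (y : ℂ)))) * (Pib y : ℂ))
    (b : ℝ) (hb : 1 ≤ b) :
    (φC (b : ℂ)).re ≤ (m + σ2 + ∫ y in Set.Ioi (0:ℝ), min 1 y * Pib y) * b := by
  have hb0 : 0 ≤ b := by linarith
  rw [phi_re0 h0 hanti hint hrepC b hb0]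
  have : ∫ y in Set.Ioi (0:ℝ), F Pib b 0 y ≤ b * ∫ y in Set.Ioi (0:ℝ), min 1 y * Pib y := by
    rw [← integral_const_mul]
    refine setIntegral_mono_on (integrable_F h0 hanti hint b 0 hb0)
      (hint.const_mul _) measurableSet_Ioi fun y hy => ?_
    have hy' : 0 < y := hy
    unfold F
    rw [← mul_assoc]
    refine mul_le_mul_of_nonneg_right ?_ (h0 y hy)
    simp only [zero_mul, Real.cos_zero, mul_one]
    rw [mul_min_of_nonneg _ _ hb0]
    refine le_min ?_ ?_
    · linarith [Real.exp_pos (-(b * y))]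
    · linarith [Real.add_one_le_exp (-(b * y))]
  nlinarith

lemma part_two_sigma {Pib : ℝ → ℝ} {φC : ℂ → ℂ} {m σ2 : ℝ} (hm : 0 ≤ m) (hσ : 0 < σ2)
    (h0 : ∀ y : ℝ, 0 < y → 0 ≤ Pib y)
    (hanti : ∀ x y : ℝ, 0 < x → x ≤ y → Pib y ≤ Pib x)
    (hint : IntegrableOn (fun y : ℝ => min 1 y * Pib y) (Set.Ioi 0))
    (hrepC : ∀ z : ℂ, 0 ≤ z.re →
      φC z = (m : ℂ) + (σ2 : ℂ) * z
        + ∫ y in Set.Ioi (0:ℝ), (1 - Complex.exp (-(z * (y : ℂ)))) * (Pib y : ℂ))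
    (hnd : ¬ (m = 0 ∧ σ2 = 0 ∧ ∀ y : ℝ, 0 < y → Pib y = 0)) :
    ∃ L : ℝ, 0 < L ∧ ∀ᶠ b in Filter.atTop, L ≤ Theta φC 0 b := by
  have hM : 0 ≤ ∫ y in Set.Ioi (0:ℝ), min 1 y * Pib y :=
    setIntegral_nonneg measurableSet_Ioi fun y hy =>
      mul_nonneg (le_min zero_le_one (le_of_lt hy)) (h0 y hy)
  obtain ⟨C, hC⟩ : ∃ C, C = m + σ2 + ∫ y in Set.Ioi (0:ℝ), min 1 y * Pib y := ⟨_, rfl⟩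
  have hC0 : 0 < C := by linarith
  set k := σ2 / 2 / C with hk
  have hk0 : 0 < k := by positivity
  refine ⟨Real.log (1 + k ^ 2) / 2, ?_, ?_⟩
  · have : 0 < Real.log (1 + k ^ 2) := Real.log_pos (by nlinarith)
    linarith
  filter_upwards [Filter.eventually_ge_atTop 1,
    (tend_zero h0 hanti hint).eventually_lt_const (half_pos hσ)] with b hb hε
  have hb0 : 0 < b := by linarith
  apply (theta_facts hm hσ.le h0 hanti hint hrepC hnd b hb0).2
  intro u hu hu1
  have hx : 0 < b * u := by positivity
  have hxb : b * u ≤ b := by nlinarith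
  have hp := phi_pos hm hσ.le h0 hanti hint hrepC hnd (b * u) hx
  have hmono := phi_mono hσ.le h0 hanti hint hrepC (b * u) b hx.le hxb
  have hlin := phi_le_lin hm h0 hanti hint hrepC b hb
  rw [← hC] at hlin
  have hre := re_le_re h0 hanti hint hrepC (b * u) b hx.le
  have him := phi_im h0 hanti hint hrepC (b * u) b hx.le
  have hG : |∫ y in Set.Ioi (0:ℝ), G Pib (b * u) b y| ≤
      b * ∫ y in Set.Ioi (0:ℝ), min (1 / b) y * Pib y := by
    rw [← integral_const_mul]
    refine (abs_integral_le_integral_abs).trans ?_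
    refine setIntegral_mono_on (integrable_G h0 hanti hint _ b hx.le).abs ?_ measurableSet_Ioi
      fun y hy => G_abs_le h0 _ b y hx.le hy hb0
    refine Integrable.const_mul ?_ _
    refine Integrable.mono' hint (AEStronglyMeasurable.mul ?_ (aemeas hanti)) ?_
    · exact Continuous.aestronglyMeasurable (by fun_prop)
    · filter_upwards [ae_restrict_mem measurableSet_Ioi] with y hy
      have hy' : 0 < y := hy
      have h1 : 0 ≤ min (1 / b) y := le_min (by positivity) hy'.le
      have h2 : 1 / b ≤ 1 := by rw [div_le_one (by linarith)]; exact hb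
      have := h0 y hy
      rw [Real.norm_of_nonneg (by positivity)]
      gcongr
  set p := (φC ((b * u : ℝ) : ℂ)).re
  set w := φC (((b * u : ℝ) : ℂ) + (b : ℂ) * Complex.I)
  have hJ := (abs_le.1 hG).1
  have him2 : σ2 / 2 * b ≤ w.im := by
    rw [him]; nlinarith
  have hkp : k * p ≤ w.im := by
    refine le_trans ?_ him2
    calc k * p ≤ k * (C * b) := by gcongr; linarith
      _ = σ2 / 2 * b := by rw [hk]; field_simp
  have hsq : 1 + k ^ 2 ≤ (‖w‖ / p) ^ 2 := by
    rw [div_pow ‖w‖ p, le_div_iff₀ (by positivity), Complex.sq_norm, Complex.normSq_apply]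
    have a1 := mul_self_le_mul_self hp.le hre
    have a2 := mul_self_le_mul_self (by positivity : 0 ≤ k * p) hkp
    nlinarith
  have := Real.log_le_log (by positivity) hsq
  rw [Real.log_pow] at this
  push_cast at this
  linarith

end BNaux

/-- lower bound for `Θ_φ(0,b)` for a `B_N` Bernstein function, and the
sufficient condition (`σ² > 0` or `liminf Π̄(1/u)/ψ(u) > 0`) for `liminf Θ_φ(0,b) > 0`. -/
theorem bernstein_Theta_lower_bound_NG
    (φC : ℂ → ℂ) (Pib : ℝ → ℝ) (m σ2 : ℝ)
    (hm : 0 ≤ m) (hσ : 0 ≤ σ2)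
    (hPib_nonneg : ∀ y : ℝ, 0 < y → 0 ≤ Pib y)
    (hPib_anti : ∀ x y : ℝ, 0 < x → x ≤ y → Pib y ≤ Pib x)
    (hPib_int : IntegrableOn (fun y : ℝ => min 1 y * Pib y) (Set.Ioi 0))
    (hrepC : ∀ z : ℂ, 0 ≤ z.re →
      φC z = (m : ℂ) + (σ2 : ℂ) * z
        + ∫ y in Set.Ioi (0:ℝ), (1 - Complex.exp (-(z * (y : ℂ)))) * (Pib y : ℂ))
    (hnd : ¬ (m = 0 ∧ σ2 = 0 ∧ ∀ y : ℝ, 0 < y → Pib y = 0)) :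
    (∀ b : ℝ, 0 < b →
      Real.log (1 + 2 / (3 * Real.exp 1 * Real.pi ^ 2)
          * (Pib (1 / b) / (b * (φC ((b : ℝ) : ℂ)).re)))
        ≤ Theta φC 0 b)
    ∧ ((0 < σ2 ∨ ∃ c : ℝ, 0 < c ∧ ∀ᶠ u in Filter.atTop,
          c ≤ Pib (1 / u) / (u * (φC ((u : ℝ) : ℂ)).re)) →
        0 < Filter.liminf (fun b : ℝ => Theta φC 0 b) Filter.atTop) := by

  refine ⟨fun b hb => BNaux.part_one hm hσ hPib_nonneg hPib_anti hPib_int hrepC hnd b hb, fun h => ?_⟩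
  have hex : ∃ L : ℝ, 0 < L ∧ ∀ᶠ b in Filter.atTop, L ≤ Theta φC 0 b := by
    rcases h with h | ⟨c, hc, h⟩
    · exact BNaux.part_two_sigma hm h hPib_nonneg hPib_anti hPib_int hrepC hnd
    · have hK : 0 < 2 / (3 * Real.exp 1 * Real.pi ^ 2) := by
        have := Real.pi_pos
        positivity
      refine ⟨Real.log (1 + 2 / (3 * Real.exp 1 * Real.pi ^ 2) * c), Real.log_pos ?_, ?_⟩
      · have := mul_pos hK hc
        linarith
      · filter_upwards [h, Filter.eventually_gt_atTop 0] with b hcb hb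
        refine le_trans (Real.log_le_log (by positivity) ?_)
          (BNaux.part_one hm hσ hPib_nonneg hPib_anti hPib_int hrepC hnd b hb)
        gcongr
  obtain ⟨L, hL, hev⟩ := hex
  refine lt_of_lt_of_le hL (Filter.le_liminf_of_le ?_ hev)
  refine Filter.isCoboundedUnder_ge_of_eventually_le _
    (x := ∫ u in Set.Ioi (0:ℝ), Real.log (1 + 2 / u ^ 2)) ?_
  filter_upwards [Filter.eventually_gt_atTop 0] with b hb
  exact (BNaux.theta_facts hm hσ hPib_nonneg hPib_anti hPib_int hrepC hnd b hb).1
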